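/- In the MDP-with-data setup, let Q⁻ be a bounded measurable fixed point of the robust Bellman operator, Q⁻ = T_rob⁻ Q⁻, with V⁻(s) := ∫ Q⁻(s,a) π(da|s). Then: (i) for every measurable β : S×A → ℝ and every bounded measurable q_β with q_β = T_β⁻ q_β, one has q_β(s,a) ≤ Q⁻(s,a) for all (s,a); and (ii) if β⁻(s,a) attains the supremum in the definition of CVaR⁻_{τ(s,a)}( V⁻ ; P(·|s,a) ) for every (s,a) (e.g., β⁻(s,a) is a lower τ(s,a)-quantile of V⁻ under P(·|s,a)), then Q⁻ = T_{β⁻}⁻ Q⁻. Consequently Q⁻(s,a) equals the maximum of q_β(s,a) over all β such that the fixed-point equation q_β = T_β⁻ q_β admits a bounded solution. -/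

import Mathlib

open MeasureTheory ProbabilityTheory

/-- Lower conditional value-at-risk at level `τ`. -/
noncomputable def cvarLower {S : Type*} [MeasurableSpace S] (τ : ℝ) (v : S → ℝ)
    (P : Measure S) : ℝ :=
  ⨆ b : ℝ, b + τ⁻¹ * ∫ x, min (v x - b) 0 ∂P

/-- `τ(s,a) := 1/(1+Λ(s,a))`. -/
noncomputable def tauOf {Z : Type*} (Λ : Z → ℝ) (z : Z) : ℝ := (1 + Λ z)⁻¹

/-- `λ(s,a) := 1 − Λ(s,a)⁻¹`. -/
noncomputable def lamOf {Z : Type*} (Λ : Z → ℝ) (z : Z) : ℝ := 1 - (Λ z)⁻¹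

/-- `v(s) := ∫ q(s,a) π(da|s)`. -/
noncomputable def vOf {S A : Type*} [MeasurableSpace S] [MeasurableSpace A]
    (π : Kernel S A) (q : S × A → ℝ) (s : S) : ℝ :=
  ∫ a, q (s, a) ∂(π s)

/-- Robust Bellman operator
`T_rob⁻ f(s,a) = r(s,a) + γ(1−λ) ∫ f̄ dP(·|s,a) + γ λ CVaR⁻_{τ(s,a)}(f̄; P(·|s,a))`. -/
noncomputable def robustBellman {S A : Type*} [MeasurableSpace S] [MeasurableSpace A]
    (P : Kernel (S × A) S) (π : Kernel S A) (r : S × A → ℝ) (γ : ℝ) (Λ : S × A → ℝ)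
    (f : S × A → ℝ) (sa : S × A) : ℝ :=
  r sa + γ * (1 - lamOf Λ sa) * (∫ s', vOf π f s' ∂(P sa)) +
    γ * lamOf Λ sa * cvarLower (tauOf Λ sa) (vOf π f) (P sa)

/-- β-Bellman operator
`T_β⁻ f(s,a) = r + γ(1−λ) ∫ f̄ dP + γ λ (β(s,a) + τ⁻¹ ∫ min(f̄(s') − β(s,a), 0) dP)`. -/
noncomputable def betaBellman {S A : Type*} [MeasurableSpace S] [MeasurableSpace A]
    (P : Kernel (S × A) S) (π : Kernel S A) (r : S × A → ℝ) (γ : ℝ) (Λ : S × A → ℝ)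
    (β : S × A → ℝ) (f : S × A → ℝ) (sa : S × A) : ℝ :=
  r sa + γ * (1 - lamOf Λ sa) * (∫ s', vOf π f s' ∂(P sa)) +
    γ * lamOf Λ sa *
      (β sa + (tauOf Λ sa)⁻¹ * ∫ s', min (vOf π f s' - β sa) 0 ∂(P sa))

open Filter Topology

section BellmanComparison

variable {S A : Type*} [MeasurableSpace S] [MeasurableSpace A]

lemma MeasureTheory.Integrable.of_measurable_of_abs_le {μ : Measure S} [IsFiniteMeasure μ] {v : S → ℝ}
    (hv : Measurable v) {M : ℝ} (hM : ∀ x, |v x| ≤ M) : Integrable v μ :=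
  Integrable.of_bound hv.aestronglyMeasurable M (ae_of_all _ hM)

lemma measurable_vOf (π : Kernel S A) [IsMarkovKernel π] {q : S × A → ℝ} (hq : Measurable q) :
    Measurable (vOf π q) :=
  hq.stronglyMeasurable.integral_kernel_prod_right'.measurable

lemma abs_vOf_le (π : Kernel S A) [IsMarkovKernel π] {q : S × A → ℝ} {M : ℝ}
    (hM : ∀ z, |q z| ≤ M) (s : S) : |vOf π q s| ≤ M := by
  have h := norm_integral_le_of_norm_le_const (μ := π s) (f := fun a => q (s, a))
    (ae_of_all _ fun a => hM (s, a))
  simpa [vOf] using h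

lemma vOf_le_vOf_add (π : Kernel S A) [IsMarkovKernel π] {q Q : S × A → ℝ} (hq : Measurable q)
    (hQ : Measurable Q) {M N D : ℝ} (hM : ∀ z, |q z| ≤ M) (hN : ∀ z, |Q z| ≤ N)
    (h : ∀ z, q z ≤ Q z + D) (s : S) : vOf π q s ≤ vOf π Q s + D := by
  have hiq : Integrable (fun a => q (s, a)) (π s) :=
    .of_measurable_of_abs_le (by fun_prop) fun a => hM (s, a)
  have hiQ : Integrable (fun a => Q (s, a)) (π s) :=
    .of_measurable_of_abs_le (by fun_prop) fun a => hN (s, a)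
  calc vOf π q s ≤ ∫ a, (Q (s, a) + D) ∂(π s) :=
        integral_mono hiq (hiQ.add (integrable_const D)) fun a => h (s, a)
    _ = vOf π Q s + D := by
        rw [integral_add hiQ (integrable_const D)]
        simp [vOf]

/-- The shortfall `min (v - b) 0` is integrable whenever `v` is. -/
lemma integrable_min_sub_zero {μ : Measure S} [IsFiniteMeasure μ] {v : S → ℝ}
    (hv : Integrable v μ) (b : ℝ) : Integrable (fun x => min (v x - b) 0) μ :=
  (hv.sub (integrable_const b)).inf (integrable_zero _ _ _)

/-- The CVaR objective is bounded above by the mean. -/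
lemma cvar_objective_le_integral {μ : Measure S} [IsProbabilityMeasure μ] {v : S → ℝ}
    (hv : Integrable v μ) {τ : ℝ} (hτ : 1 ≤ τ⁻¹) (b : ℝ) :
    b + τ⁻¹ * ∫ x, min (v x - b) 0 ∂μ ≤ ∫ x, v x ∂μ := by
  have hnonpos : ∫ x, min (v x - b) 0 ∂μ ≤ 0 := integral_nonpos fun x => min_le_right _ _
  have hmean : ∫ x, min (v x - b) 0 ∂μ ≤ (∫ x, v x ∂μ) - b := by
    calc ∫ x, min (v x - b) 0 ∂μ ≤ ∫ x, (v x - b) ∂μ :=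
          integral_mono (integrable_min_sub_zero hv b) (hv.sub (integrable_const b))
            fun x => min_le_left _ _
      _ = (∫ x, v x ∂μ) - b := by
          rw [integral_sub hv (integrable_const b)]
          simp
  nlinarith

/-- Monotonicity and translation equivariance of CVaR, at the level of the objective. -/
lemma cvar_objective_le_cvarLower_add {μ : Measure S} [IsProbabilityMeasure μ] {v w : S → ℝ}
    (hv : Integrable v μ) (hw : Integrable w μ) {τ D : ℝ} (hτ : 1 ≤ τ⁻¹)
    (h : ∀ x, v x ≤ w x + D) (b : ℝ) :
    b + τ⁻¹ * ∫ x, min (v x - b) 0 ∂μ ≤ cvarLower τ w μ + D := by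
  have hbdd : BddAbove (Set.range fun c : ℝ => c + τ⁻¹ * ∫ x, min (w x - c) 0 ∂μ) :=
    ⟨∫ x, w x ∂μ, by
      rintro _ ⟨c, rfl⟩
      exact cvar_objective_le_integral hw hτ c⟩
  have hsup : (b - D) + τ⁻¹ * ∫ x, min (w x - (b - D)) 0 ∂μ ≤ cvarLower τ w μ :=
    le_ciSup hbdd (b - D)
  have hmono : ∫ x, min (v x - b) 0 ∂μ ≤ ∫ x, min (w x - (b - D)) 0 ∂μ :=
    integral_mono (integrable_min_sub_zero hv b) (integrable_min_sub_zero hw (b - D))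
      fun x => min_le_min_right 0 (by linarith [h x])
  have := mul_le_mul_of_nonneg_left hmono (zero_le_one.trans hτ)
  linarith

/-- The β-Bellman operator is dominated by the robust one, up to a discounted shift. -/
lemma betaBellman_le_robustBellman_add (P : Kernel (S × A) S) [IsMarkovKernel P]
    (π : Kernel S A) [IsMarkovKernel π] (r : S × A → ℝ) {γ : ℝ} (hγ : 0 ≤ γ)
    {Λ : S × A → ℝ} (hΛ : ∀ z, 1 ≤ Λ z) (β : S × A → ℝ) {q Q : S × A → ℝ}
    (hq : Measurable q) (hQ : Measurable Q) {M N D : ℝ} (hM : ∀ z, |q z| ≤ M)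
    (hN : ∀ z, |Q z| ≤ N) (h : ∀ z, q z ≤ Q z + D) (z : S × A) :
    betaBellman P π r γ Λ β q z ≤ robustBellman P π r γ Λ Q z + γ * D := by
  have hvq : Integrable (vOf π q) (P z) :=
    .of_measurable_of_abs_le (measurable_vOf π hq) (abs_vOf_le π hM)
  have hvQ : Integrable (vOf π Q) (P z) :=
    .of_measurable_of_abs_le (measurable_vOf π hQ) (abs_vOf_le π hN)
  have hv := vOf_le_vOf_add π hq hQ hM hN h
  have hΛpos : 0 < Λ z := zero_lt_one.trans_le (hΛ z)
  have hτ : 1 ≤ (tauOf Λ z)⁻¹ := by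
    rw [tauOf, inv_inv]
    linarith
  have hlam : 0 ≤ lamOf Λ z := sub_nonneg.2 (inv_le_one_of_one_le₀ (hΛ z))
  have hlam' : 0 ≤ 1 - lamOf Λ z := by
    rw [lamOf, sub_sub_cancel]
    positivity
  have hint : ∫ s, vOf π q s ∂(P z) ≤ (∫ s, vOf π Q s ∂(P z)) + D := by
    calc ∫ s, vOf π q s ∂(P z) ≤ ∫ s, (vOf π Q s + D) ∂(P z) :=
          integral_mono hvq (hvQ.add (integrable_const D)) hv
      _ = _ := by
          rw [integral_add hvQ (integrable_const D)]
          simp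
  have hcvar := cvar_objective_le_cvarLower_add hvq hvQ hτ hv (β z)
  have hmean := mul_le_mul_of_nonneg_left hint (mul_nonneg hγ hlam')
  have htail := mul_le_mul_of_nonneg_left hcvar (mul_nonneg hγ hlam)
  unfold betaBellman robustBellman
  linarith

/-- Every bounded measurable fixed point of a β-Bellman operator lies below every bounded
measurable fixed point of the robust Bellman operator. -/
lemma betaBellman_fixedPoint_le (P : Kernel (S × A) S) [IsMarkovKernel P]
    (π : Kernel S A) [IsMarkovKernel π] (r : S × A → ℝ) {γ : ℝ} (hγ : γ ∈ Set.Ico (0 : ℝ) 1)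
    {Λ : S × A → ℝ} (hΛ : ∀ z, 1 ≤ Λ z) (β : S × A → ℝ) {q Q : S × A → ℝ}
    (hq : Measurable q) (hQ : Measurable Q) {M N : ℝ} (hM : ∀ z, |q z| ≤ M)
    (hN : ∀ z, |Q z| ≤ N) (hqfix : ∀ z, q z = betaBellman P π r γ Λ β q z)
    (hQfix : ∀ z, Q z = robustBellman P π r γ Λ Q z) (z : S × A) : q z ≤ Q z := by
  have hpow : ∀ (n : ℕ) (z : S × A), q z ≤ Q z + γ ^ n * (M + N) := by
    intro n
    induction n with
    | zero =>
      intro z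
      linarith [(abs_le.1 (hM z)).2, (abs_le.1 (hN z)).1]
    | succ n ih =>
      intro z
      have hstep := betaBellman_le_robustBellman_add P π r hγ.1 hΛ β hq hQ hM hN ih z
      rw [← hqfix, ← hQfix] at hstep
      rwa [pow_succ', mul_assoc]
  have hlim : Tendsto (fun n : ℕ => Q z + γ ^ n * (M + N)) atTop (𝓝 (Q z)) := by
    simpa using
      ((tendsto_pow_atTop_nhds_zero_of_lt_one hγ.1 hγ.2).mul_const (M + N)).const_add (Q z)
  exact ge_of_tendsto' hlim fun n => hpow n z

end BellmanComparison

/-- Dual characterization of the robust `Q`-function: (i) any bounded measurable fixed point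
`q_β` of `T_β⁻` is dominated by `Q⁻`; (ii) if `β⁻` attains the CVaR supremum everywhere, then
`Q⁻` is a fixed point of `T_{β⁻}⁻`; consequently `Q⁻(s,a)` is the supremum of `q_β(s,a)`
over all `β` whose fixed-point equation admits a bounded measurable solution. -/
theorem robust_q_dual_characterization
    {S A : Type*} [MeasurableSpace S] [MeasurableSpace A]
    (P : Kernel (S × A) S) [IsMarkovKernel P] (π : Kernel S A) [IsMarkovKernel π]
    (r : S × A → ℝ) (hr_meas : Measurable r) (hr_bdd : ∀ z, r z ∈ Set.Icc (0 : ℝ) 1)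
    (γ : ℝ) (hγ : γ ∈ Set.Ico (0 : ℝ) 1)
    (Λ : S × A → ℝ) (hΛ_meas : Measurable Λ) (hΛ_lb : ∀ sa, 1 ≤ Λ sa)
    (MΛ : ℝ) (hΛ_ub : ∀ sa, Λ sa ≤ MΛ)
    (Qm : S × A → ℝ) (hQ_meas : Measurable Qm) (MQ : ℝ) (hQ_bdd : ∀ sa, |Qm sa| ≤ MQ)
    (hQ_fixed : ∀ sa, Qm sa = robustBellman P π r γ Λ Qm sa) :
    (∀ β : S × A → ℝ, Measurable β →
      ∀ qβ : S × A → ℝ, Measurable qβ → (∃ M : ℝ, ∀ sa, |qβ sa| ≤ M) →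
        (∀ sa, qβ sa = betaBellman P π r γ Λ β qβ sa) →
        ∀ sa, qβ sa ≤ Qm sa) ∧
    (∀ βm : S × A → ℝ,
      (∀ sa, βm sa + (tauOf Λ sa)⁻¹ * (∫ s', min (vOf π Qm s' - βm sa) 0 ∂(P sa)) =
        cvarLower (tauOf Λ sa) (vOf π Qm) (P sa)) →
      ∀ sa, Qm sa = betaBellman P π r γ Λ βm Qm sa) ∧
    ((∃ βm : S × A → ℝ, Measurable βm ∧
        ∀ sa, βm sa + (tauOf Λ sa)⁻¹ * (∫ s', min (vOf π Qm s' - βm sa) 0 ∂(P sa)) =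
          cvarLower (tauOf Λ sa) (vOf π Qm) (P sa)) →
      ∀ sa, Qm sa =
        sSup {y : ℝ | ∃ (β qβ : S × A → ℝ), Measurable β ∧ Measurable qβ ∧
          (∃ M : ℝ, ∀ z, |qβ z| ≤ M) ∧
          (∀ z, qβ z = betaBellman P π r γ Λ β qβ z) ∧ y = qβ sa}) := by
  have hle : ∀ β : S × A → ℝ, Measurable β →
      ∀ qβ : S × A → ℝ, Measurable qβ → (∃ M : ℝ, ∀ sa, |qβ sa| ≤ M) →
        (∀ sa, qβ sa = betaBellman P π r γ Λ β qβ sa) → ∀ sa, qβ sa ≤ Qm sa := by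
    rintro β - q hq ⟨M, hM⟩ hfix
    exact betaBellman_fixedPoint_le P π r hγ hΛ_lb β hq hQ_meas hM hQ_bdd hfix hQ_fixed
  have hfixed : ∀ βm : S × A → ℝ,
      (∀ sa, βm sa + (tauOf Λ sa)⁻¹ * (∫ s', min (vOf π Qm s' - βm sa) 0 ∂(P sa)) =
        cvarLower (tauOf Λ sa) (vOf π Qm) (P sa)) →
      ∀ sa, Qm sa = betaBellman P π r γ Λ βm Qm sa := by
    intro βm hβm sa
    rw [betaBellman, hβm sa]
    exact hQ_fixed sa
  refine ⟨hle, hfixed, ?_⟩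
  rintro ⟨βm, hmeas, hβm⟩ sa
  refine (IsGreatest.csSup_eq ⟨?_, ?_⟩).symm
  · exact ⟨βm, Qm, hmeas, hQ_meas, ⟨MQ, hQ_bdd⟩, hfixed βm hβm, rfl⟩
  · rintro _ ⟨β, q, hβ, hq, hM, hfix, rfl⟩
    exact hle β hβ q hq hM hfix sa
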